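/- For natural numbers m and n, define p(m, j) = ∫_ℝ t^j · e^{−t²/2} · He_m(t)² dt and q(m, n) = ∫_ℝ t^n · (D_m'(t))² dt, where D_m(t) = e^{−t²/4}·He_m(t) and D_m' is its derivative, so that D_m'(t) = e^{−t²/4}·(He_m'(t) − (t/2)·He_m(t)). Then 4(n + 1) · q(m, n) = (n + 3) · p(m, n + 2) − 2(n + 1)(2m + 1) · p(m, n). -/

import Mathlib

/-- The `m`-th probabilists' Hermite polynomial, as a real function. -/
noncomputable def He (m : ℕ) (t : ℝ) : ℝ := Polynomial.aeval t (Polynomial.hermite m)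

/-- The parabolic cylinder function `Dₘ(t) = e^{-t²/4} Heₘ(t)` of integer order. -/
noncomputable def D (m : ℕ) (t : ℝ) : ℝ := Real.exp (-t ^ 2 / 4) * He m t

open Polynomial in
/-- Hermite's differential equation. -/
theorem Polynomial.derivative_derivative_hermite (m : ℕ) :
    derivative (derivative (hermite m)) = X * derivative (hermite m) - (m : ℤ[X]) * hermite m := by
  induction m with
  | zero => simp
  | succ k ih =>
    have h : derivative (hermite (k + 1)) = ((k : ℤ[X]) + 1) * hermite k := by
      rw [hermite_succ, derivative_sub, derivative_mul, derivative_X, ih]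
      ring
    have h' : derivative ((k : ℤ[X]) + 1) = 0 := by simp
    rw [h, derivative_mul, h', hermite_succ]
    push_cast
    ring

open Polynomial in
theorem Polynomial.integrable_exp_neg_sq_div_two_mul_eval (P : ℝ[X]) :
    MeasureTheory.Integrable fun t : ℝ => Real.exp (-t ^ 2 / 2) * P.eval t := by
  induction P using Polynomial.induction_on' with
  | add p q hp hq =>
    refine (hp.add hq).congr (.of_forall fun t => ?_)
    simp [mul_add]
  | monomial k a =>
    have h := (integrable_rpow_mul_exp_neg_mul_sq (b := 1 / 2) (by norm_num) (s := k)
      (by linarith [k.cast_nonneg (α := ℝ)])).mul_const a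
    refine h.congr (.of_forall fun t => ?_)
    simp only [eval_monomial, Real.rpow_natCast]
    rw [show -(1 / 2) * t ^ 2 = -t ^ 2 / 2 by ring]
    ring

open Polynomial in
theorem Polynomial.integral_exp_neg_sq_div_two_mul_eval_derivative_sub (P : ℝ[X]) :
    ∫ t : ℝ, Real.exp (-t ^ 2 / 2) * (derivative P - X * P).eval t = 0 := by
  refine MeasureTheory.integral_eq_zero_of_hasDerivAt_of_integrable (fun t => ?_)
    (integrable_exp_neg_sq_div_two_mul_eval _) (integrable_exp_neg_sq_div_two_mul_eval P)
  have h : HasDerivAt (fun t : ℝ => -t ^ 2 / 2) (-t) t := by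
    refine ((hasDerivAt_pow 2 t).fun_neg.div_const 2).congr_deriv ?_
    push_cast
    ring
  refine (h.exp.mul (P.hasDerivAt t)).congr_deriv ?_
  simp only [eval_sub, eval_mul, eval_X]
  ring

/-- With `p(m,j) = ∫ℝ tʲ e^{-t²/2} Heₘ(t)² dt` and `q(m,n) = ∫ℝ tⁿ (Dₘ'(t))² dt`,
one has `4(n+1) q(m,n) = (n+3) p(m,n+2) - 2(n+1)(2m+1) p(m,n)`. -/
theorem stmt13 (m n : ℕ) (p : ℕ → ℕ → ℝ) (q : ℕ → ℕ → ℝ)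
    (hp : ∀ m' j : ℕ, p m' j = ∫ t : ℝ, t ^ j * Real.exp (-t ^ 2 / 2) * (He m' t) ^ 2)
    (hq : ∀ m' j : ℕ, q m' j = ∫ t : ℝ, t ^ j * (deriv (D m') t) ^ 2)
    (hD' : ∀ t : ℝ, deriv (D m) t =
      Real.exp (-t ^ 2 / 4) * (deriv (He m) t - (t / 2) * He m t)) :
    4 * ((n : ℝ) + 1) * q m n =
      ((n : ℝ) + 3) * p m (n + 2) - 2 * ((n : ℝ) + 1) * (2 * (m : ℝ) + 1) * p m n := by
  set H : Polynomial ℝ := (Polynomial.hermite m).map (Int.castRingHom ℝ) with hH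
  set G : Polynomial ℝ := H.derivative - Polynomial.C (1 / 2) * Polynomial.X * H with hG
  have hHe : ∀ t, He m t = H.eval t := fun t => by
    simp [He, hH, Polynomial.aeval_def, Polynomial.eval_map]
  have hdHe : ∀ t, deriv (He m) t = H.derivative.eval t := fun t => by
    rw [funext hHe, Polynomial.deriv]
  have ode : H.derivative.derivative =
      Polynomial.X * H.derivative - Polynomial.C (m : ℝ) * H := by
    have := congrArg (Polynomial.map (Int.castRingHom ℝ))
      (Polynomial.derivative_derivative_hermite m)
    simpa [hH, Polynomial.derivative_map] using this
  have hp' : ∀ j, p m j =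
      ∫ t : ℝ, Real.exp (-t ^ 2 / 2) * (Polynomial.X ^ j * H ^ 2).eval t := fun j => by
    rw [hp]
    refine MeasureTheory.integral_congr_ae (.of_forall fun t => ?_)
    simp only [hHe, Polynomial.eval_mul, Polynomial.eval_pow, Polynomial.eval_X]
    ring
  have hq' : q m n =
      ∫ t : ℝ, Real.exp (-t ^ 2 / 2) * (Polynomial.X ^ n * G ^ 2).eval t := by
    rw [hq]
    refine MeasureTheory.integral_congr_ae (.of_forall fun t => ?_)
    have he : Real.exp (-t ^ 2 / 2) = Real.exp (-t ^ 2 / 4) ^ 2 := by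
      rw [← Real.exp_nat_mul]
      congr 1
      push_cast
      ring
    simp only [hD', hdHe, hHe, he, hG, Polynomial.eval_mul, Polynomial.eval_pow,
      Polynomial.eval_X, Polynomial.eval_sub, Polynomial.eval_C]
    ring
  have key := Polynomial.integral_exp_neg_sq_div_two_mul_eval_derivative_sub
    (Polynomial.X ^ (n + 1) *
      (G ^ 2 - (Polynomial.C (1 / 4) * Polynomial.X ^ 2 - Polynomial.C (m + 1 / 2 : ℝ)) * H ^ 2))
  have hpt : ∀ t : ℝ, Real.exp (-t ^ 2 / 2) * (Polynomial.derivative (Polynomial.X ^ (n + 1) *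
      (G ^ 2 - (Polynomial.C (1 / 4) * Polynomial.X ^ 2 - Polynomial.C (m + 1 / 2 : ℝ)) * H ^ 2))
      - Polynomial.X * (Polynomial.X ^ (n + 1) *
      (G ^ 2 - (Polynomial.C (1 / 4) * Polynomial.X ^ 2
        - Polynomial.C (m + 1 / 2 : ℝ)) * H ^ 2))).eval t =
      ((n : ℝ) + 1) * (Real.exp (-t ^ 2 / 2) * (Polynomial.X ^ n * G ^ 2).eval t)
      - (((n : ℝ) + 3) / 4) * (Real.exp (-t ^ 2 / 2) * (Polynomial.X ^ (n + 2) * H ^ 2).eval t)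
      + (((n : ℝ) + 1) * (m + 1 / 2)) *
        (Real.exp (-t ^ 2 / 2) * (Polynomial.X ^ n * H ^ 2).eval t) := fun t => by
    simp only [hG, Polynomial.derivative_mul, Polynomial.derivative_sub,
      Polynomial.derivative_pow, Polynomial.derivative_C,
      Polynomial.derivative_X, ode, Polynomial.eval_mul, Polynomial.eval_sub, Polynomial.eval_add,
      Polynomial.eval_pow, Polynomial.eval_X, Polynomial.eval_C, Polynomial.eval_zero,
      Polynomial.eval_one, Nat.add_sub_cancel]
    push_cast
    ring
  have hi := Polynomial.integrable_exp_neg_sq_div_two_mul_eval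
  rw [funext hpt, MeasureTheory.integral_add
      (((hi _).const_mul _).sub' ((hi _).const_mul _)) ((hi _).const_mul _),
    MeasureTheory.integral_sub ((hi _).const_mul _) ((hi _).const_mul _),
    MeasureTheory.integral_const_mul, MeasureTheory.integral_const_mul,
    MeasureTheory.integral_const_mul, ← hq', ← hp', ← hp'] at key
  linarith
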